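/- Let Ω ⊂ ℝ be an open bounded interval, let f satisfy hypothesis (F), let the data satisfy the smooth-data hypothesis (I∞), and let T > 0. Then there exists C(T) > 0 such that the classical solutions of the regularized problems (P_ε) satisfy sup_{t∈(0,T)} {‖v_ε(·,t)‖_{L²(Ω)} + ‖Θ_ε(·,t)‖_{L¹(Ω)}} + ∫₀^T∫_Ω Θ_{εx}² ≤ C(T) for all ε ∈ (0,1). -/

import Mathlib

open MeasureTheory Filter Set Function

noncomputable section

/-- Integral over `Ω = (a,b)`. -/
def intOm (a b : ℝ) (g : ℝ → ℝ) : ℝ := ∫ x in Ioo a b, g x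

/-- Double integral over `Ω × (0,T)`. -/
def intOmT (a b T : ℝ) (F : ℝ → ℝ → ℝ) : ℝ :=
  ∫ p in (Ioo a b) ×ˢ (Ioo 0 T), F p.1 p.2

/-- Squared `L²(Ω)` integral of `g`. -/
def sqOm (a b : ℝ) (g : ℝ → ℝ) : ℝ := ∫ x in Ioo a b, (g x) ^ 2

/-- `L²(Ω)` norm. -/
def nrmL2 (a b : ℝ) (g : ℝ → ℝ) : ℝ := (∫ x in Ioo a b, (g x) ^ 2) ^ (1 / 2 : ℝ)

/-- `L¹(Ω)` norm. -/
def nrmL1 (a b : ℝ) (g : ℝ → ℝ) : ℝ := ∫ x in Ioo a b, |g x|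

/-- Membership in `L²(Ω)`. -/
def MemL2 (a b : ℝ) (g : ℝ → ℝ) : Prop :=
  AEStronglyMeasurable g (volume.restrict (Ioo a b)) ∧
    IntegrableOn (fun x => (g x) ^ 2) (Ioo a b)

/-- Zero-trace weak derivative on `(a,b)`: `g ∈ W₀^{1,1}(a,b)` with weak derivative `g'`
(integration by parts against all smooth test functions, with no boundary terms). -/
def WeakDerivZ (a b : ℝ) (g g' : ℝ → ℝ) : Prop :=
  ∀ ψ : ℝ → ℝ, ContDiff ℝ (⊤ : ℕ∞) ψ →
    ∫ x in Ioo a b, g x * deriv ψ x = - ∫ x in Ioo a b, g' x * ψ x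

/-- Interior weak derivative on `(a,b)`: `g ∈ W^{1,1}(a,b)` with weak derivative `g'`. -/
def WeakDerivI (a b : ℝ) (g g' : ℝ → ℝ) : Prop :=
  ∀ ψ : ℝ → ℝ, ContDiff ℝ (⊤ : ℕ∞) ψ → tsupport ψ ⊆ Ioo a b →
    ∫ x in Ioo a b, g x * deriv ψ x = - ∫ x in Ioo a b, g' x * ψ x

/-- Hypothesis (F) on the nonlinearity `f`, where `f'`, `f''` denote its first and second
derivatives on `[0,∞)`: `f ∈ C²([0,∞))`, `f(0)=0`, `f' > 0` on `[0,∞)`,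
and `f' ∈ W^{1,∞}((0,∞))` (i.e. `f'` and `f''` are bounded). -/
structure HypF (f f' f'' : ℝ → ℝ) : Prop where
  hasDeriv₁ : ∀ x ∈ Ici (0 : ℝ), HasDerivWithinAt f (f' x) (Ici 0) x
  hasDeriv₂ : ∀ x ∈ Ici (0 : ℝ), HasDerivWithinAt f' (f'' x) (Ici 0) x
  cont₂ : ContinuousOn f'' (Ici 0)
  zero : f 0 = 0
  pos : ∀ x ∈ Ici (0 : ℝ), 0 < f' x
  bdd : ∃ M : ℝ, ∀ x ∈ Ici (0 : ℝ), |f' x| ≤ M ∧ |f'' x| ≤ M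

/-- Partial derivative in the first (spatial) variable. -/
def pdx (w : ℝ → ℝ → ℝ) : ℝ → ℝ → ℝ := fun x t => deriv (fun y => w y t) x

/-- Partial derivative in the second (time) variable. -/
def pdt (w : ℝ → ℝ → ℝ) : ℝ → ℝ → ℝ := fun x t => deriv (fun s => w x s) t

/-- Test functions in `C₀^∞(Ω × [0,T))`. -/
structure TestU (a b T : ℝ) (φ : ℝ → ℝ → ℝ) : Prop where
  smooth : ContDiff ℝ (⊤ : ℕ∞) (uncurry φ)
  suppx : ∃ K : Set ℝ, IsCompact K ∧ K ⊆ Ioo a b ∧ ∀ x t, x ∉ K → φ x t = 0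
  suppt : ∃ T' : ℝ, T' < T ∧ ∀ x t, T' ≤ t → φ x t = 0

/-- Test functions in `C^∞(Ω̄ × [0,T))`, compactly supported in time. -/
structure TestT (T : ℝ) (φ : ℝ → ℝ → ℝ) : Prop where
  smooth : ContDiff ℝ (⊤ : ℕ∞) (uncurry φ)
  suppt : ∃ T' : ℝ, T' < T ∧ ∀ x t, T' ≤ t → φ x t = 0

/-- Test functions in `C₀^∞(Ω × (0,T))`. -/
structure TestInt (a b T : ℝ) (φ : ℝ → ℝ → ℝ) : Prop where
  smooth : ContDiff ℝ (⊤ : ℕ∞) (uncurry φ)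
  suppx : ∃ K : Set ℝ, IsCompact K ∧ K ⊆ Ioo a b ∧ ∀ x t, x ∉ K → φ x t = 0
  supptime : ∃ K : Set ℝ, IsCompact K ∧ K ⊆ Ioo 0 T ∧ ∀ x t, t ∉ K → φ x t = 0

/-- Definition (W): weak solution of (P) on `Ω × (0,T)`.  Here `ut`, `ux`, `Θx` denote
the weak derivatives of `u` (in time and space) and of `Θ` (in space). -/
structure IsWeakSol (a b T : ℝ) (f f' : ℝ → ℝ) (u0 u0t Θ0 : ℝ → ℝ)
    (u ut ux Θ Θx : ℝ → ℝ → ℝ) : Prop where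
  u_sliceL1 : ∀ t ∈ Icc 0 T, IntegrableOn (fun x => u x t) (Ioo a b)
  u_contL1 : ∀ t₀ ∈ Icc 0 T,
    Tendsto (fun t => ∫ x in Ioo a b, |u x t - u x t₀|) (nhdsWithin t₀ (Icc 0 T)) (nhds 0)
  u_int : IntegrableOn (fun p : ℝ × ℝ => u p.1 p.2) ((Ioo a b) ×ˢ (Ioo 0 T))
  ux_int : IntegrableOn (fun p : ℝ × ℝ => ux p.1 p.2) ((Ioo a b) ×ˢ (Ioo 0 T))
  u_W0 : ∀ᵐ t ∂volume.restrict (Ioo 0 T), WeakDerivZ a b (fun x => u x t) (fun x => ux x t)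
  Θ_int : IntegrableOn (fun p : ℝ × ℝ => Θ p.1 p.2) ((Ioo a b) ×ˢ (Ioo 0 T))
  Θx_int : IntegrableOn (fun p : ℝ × ℝ => Θx p.1 p.2) ((Ioo a b) ×ˢ (Ioo 0 T))
  Θ_W : ∀ᵐ t ∂volume.restrict (Ioo 0 T), WeakDerivI a b (fun x => Θ x t) (fun x => Θx x t)
  Θ_nonneg : ∀ᵐ p ∂volume.restrict ((Ioo a b) ×ˢ (Ioo 0 T)), 0 ≤ Θ p.1 p.2
  ut_weak : ∀ φ : ℝ → ℝ → ℝ, TestInt a b T φ →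
    intOmT a b T (fun x t => u x t * pdt φ x t) = - intOmT a b T (fun x t => ut x t * φ x t)
  ut_int : IntegrableOn (fun p : ℝ × ℝ => ut p.1 p.2) ((Ioo a b) ×ˢ (Ioo 0 T))
  g1_int : IntegrableOn (fun p : ℝ × ℝ => f' (Θ p.1 p.2) * Θx p.1 p.2)
    ((Ioo a b) ×ˢ (Ioo 0 T))
  g2_int : IntegrableOn (fun p : ℝ × ℝ => f' (Θ p.1 p.2) * Θx p.1 p.2 * ut p.1 p.2)
    ((Ioo a b) ×ˢ (Ioo 0 T))
  g3_int : IntegrableOn (fun p : ℝ × ℝ => f (Θ p.1 p.2) * ut p.1 p.2)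
    ((Ioo a b) ×ˢ (Ioo 0 T))
  weak_u : ∀ φ : ℝ → ℝ → ℝ, TestU a b T φ →
    intOmT a b T (fun x t => u x t * pdt (pdt φ) x t)
        - intOm a b (fun x => u0t x * φ x 0) + intOm a b (fun x => u0 x * pdt φ x 0)
      = - intOmT a b T (fun x t => ux x t * pdx φ x t)
        - intOmT a b T (fun x t => f' (Θ x t) * Θx x t * φ x t)
  weak_Θ : ∀ φ : ℝ → ℝ → ℝ, TestT T φ →
    - intOmT a b T (fun x t => Θ x t * pdt φ x t) - intOm a b (fun x => Θ0 x * φ x 0)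
      = - intOmT a b T (fun x t => Θx x t * pdx φ x t)
        + intOmT a b T (fun x t => f' (Θ x t) * Θx x t * ut x t * φ x t)
        + intOmT a b T (fun x t => f (Θ x t) * ut x t * pdx φ x t)

/-- Continuity of `t ↦ w(·,t)` as a map `J → L²(Ω)` (with slices in `L²(Ω)`). -/
def ContL2 (a b : ℝ) (J : Set ℝ) (w : ℝ → ℝ → ℝ) : Prop :=
  (∀ t ∈ J, MemL2 a b (fun x => w x t)) ∧
    ∀ t₀ ∈ J, Tendsto (fun t => ∫ x in Ioo a b, (w x t - w x t₀) ^ 2)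
      (nhdsWithin t₀ J) (nhds 0)

/-- The regularity class (R_T):  `u ∈ C⁰([0,T];W₀^{1,2})`, `u_t ∈ C⁰([0,T];L²)`,
`Θ ∈ C⁰([0,T];L²) ∩ L²((0,T);W^{1,2})`. -/
structure RegT (a b T : ℝ) (u ut ux Θ Θx : ℝ → ℝ → ℝ) : Prop where
  u_cont : ContL2 a b (Icc 0 T) u
  ux_cont : ContL2 a b (Icc 0 T) ux
  u_W0 : ∀ t ∈ Icc (0 : ℝ) T, WeakDerivZ a b (fun x => u x t) (fun x => ux x t)
  ut_cont : ContL2 a b (Icc 0 T) ut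
  Θ_cont : ContL2 a b (Icc 0 T) Θ
  Θ_sq_int : IntegrableOn (fun p : ℝ × ℝ => (Θ p.1 p.2) ^ 2) ((Ioo a b) ×ˢ (Ioo 0 T))
  Θx_sq_int : IntegrableOn (fun p : ℝ × ℝ => (Θx p.1 p.2) ^ 2) ((Ioo a b) ×ˢ (Ioo 0 T))

/-- Data hypothesis (I), with `u0x` the weak derivative of `u0 ∈ W₀^{1,2}(Ω)`. -/
structure DataI (a b : ℝ) (u0 u0x u0t Θ0 : ℝ → ℝ) : Prop where
  u0_L2 : MemL2 a b u0
  u0x_L2 : MemL2 a b u0x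
  u0_W0 : WeakDerivZ a b u0 u0x
  u0t_L2 : MemL2 a b u0t
  Θ0_L2 : MemL2 a b Θ0
  Θ0_nonneg : ∀ᵐ x ∂volume.restrict (Ioo a b), 0 ≤ Θ0 x

/-- Smooth-data hypothesis (I∞). -/
structure SmoothData (a b : ℝ) (v0 u0 Θ0 : ℝ → ℝ) : Prop where
  v0_smooth : ContDiff ℝ (⊤ : ℕ∞) v0
  v0_supp : ∃ K : Set ℝ, IsCompact K ∧ K ⊆ Ioo a b ∧ ∀ x, x ∉ K → v0 x = 0
  u0_smooth : ContDiff ℝ (⊤ : ℕ∞) u0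
  u0_supp : ∃ K : Set ℝ, IsCompact K ∧ K ⊆ Ioo a b ∧ ∀ x, x ∉ K → u0 x = 0
  Θ0_smooth : ContDiff ℝ (⊤ : ℕ∞) Θ0
  Θ0_pos : ∀ x ∈ Icc a b, 0 < Θ0 x
  Θ0x_supp : ∃ K : Set ℝ, IsCompact K ∧ K ⊆ Ioo a b ∧ ∀ x, x ∉ K → deriv Θ0 x = 0

/-- Classical solution of the regularized problem (P_ε), of class
`C^{4,1} × C^{2,1} × C^{2,1}(Ω̄ × [0,∞))`, with positive temperature. -/
structure IsClassicalSolEps (a b : ℝ) (f : ℝ → ℝ) (ε : ℝ) (v0 u0 Θ0 : ℝ → ℝ)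
    (v u Θ : ℝ → ℝ → ℝ) : Prop where
  diffx_v : ∀ k < 4, ∀ x ∈ Icc a b, ∀ t ∈ Ici (0 : ℝ),
    DifferentiableAt ℝ (fun y => pdx^[k] v y t) x
  difft_v : ∀ x ∈ Icc a b, ∀ t ∈ Ici (0 : ℝ), DifferentiableAt ℝ (fun s => v x s) t
  cont_v : ∀ k ≤ 4, ContinuousOn (uncurry (pdx^[k] v)) ((Icc a b) ×ˢ (Ici 0))
  contt_v : ContinuousOn (uncurry (pdt v)) ((Icc a b) ×ˢ (Ici 0))
  diffx_u : ∀ k < 2, ∀ x ∈ Icc a b, ∀ t ∈ Ici (0 : ℝ),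
    DifferentiableAt ℝ (fun y => pdx^[k] u y t) x
  difft_u : ∀ x ∈ Icc a b, ∀ t ∈ Ici (0 : ℝ), DifferentiableAt ℝ (fun s => u x s) t
  cont_u : ∀ k ≤ 2, ContinuousOn (uncurry (pdx^[k] u)) ((Icc a b) ×ˢ (Ici 0))
  contt_u : ContinuousOn (uncurry (pdt u)) ((Icc a b) ×ˢ (Ici 0))
  diffx_Θ : ∀ k < 2, ∀ x ∈ Icc a b, ∀ t ∈ Ici (0 : ℝ),
    DifferentiableAt ℝ (fun y => pdx^[k] Θ y t) x
  difft_Θ : ∀ x ∈ Icc a b, ∀ t ∈ Ici (0 : ℝ), DifferentiableAt ℝ (fun s => Θ x s) t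
  cont_Θ : ∀ k ≤ 2, ContinuousOn (uncurry (pdx^[k] Θ)) ((Icc a b) ×ˢ (Ici 0))
  contt_Θ : ContinuousOn (uncurry (pdt Θ)) ((Icc a b) ×ˢ (Ici 0))
  Θ_pos : ∀ x ∈ Icc a b, ∀ t ∈ Ici (0 : ℝ), 0 < Θ x t
  eq_v : ∀ x ∈ Ioo a b, ∀ t ∈ Ioi (0 : ℝ),
    pdt v x t = -ε * pdx^[4] v x t + pdx^[2] u x t - pdx (fun y s => f (Θ y s)) x t
  eq_u : ∀ x ∈ Ioo a b, ∀ t ∈ Ioi (0 : ℝ), pdt u x t = ε * pdx^[2] u x t + v x t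
  eq_Θ : ∀ x ∈ Ioo a b, ∀ t ∈ Ioi (0 : ℝ),
    pdt Θ x t = pdx^[2] Θ x t - f (Θ x t) * pdx v x t
  bc_v : ∀ t ∈ Ioi (0 : ℝ),
    v a t = 0 ∧ v b t = 0 ∧ pdx^[2] v a t = 0 ∧ pdx^[2] v b t = 0
  bc_u : ∀ t ∈ Ioi (0 : ℝ), u a t = 0 ∧ u b t = 0
  bc_Θ : ∀ t ∈ Ioi (0 : ℝ), pdx Θ a t = 0 ∧ pdx Θ b t = 0
  init : ∀ x ∈ Icc a b, v x 0 = v0 x ∧ u x 0 = u0 x ∧ Θ x 0 = Θ0 x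

/-- Weak convergence in `L²_loc(Ω̄ × [0,∞))`. -/
def WkL2loc (a b : ℝ) (wj : ℕ → ℝ → ℝ → ℝ) (w : ℝ → ℝ → ℝ) : Prop :=
  ∀ T > (0 : ℝ), ∀ ψ : ℝ → ℝ → ℝ,
    AEStronglyMeasurable (fun p : ℝ × ℝ => ψ p.1 p.2)
      (volume.restrict ((Icc a b) ×ˢ (Icc 0 T))) →
    IntegrableOn (fun p : ℝ × ℝ => (ψ p.1 p.2) ^ 2) ((Icc a b) ×ˢ (Icc 0 T)) →
    Tendsto (fun j => ∫ p in (Icc a b) ×ˢ (Icc 0 T), wj j p.1 p.2 * ψ p.1 p.2) atTop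
      (nhds (∫ p in (Icc a b) ×ˢ (Icc 0 T), w p.1 p.2 * ψ p.1 p.2))

/-! ### Integrals depending on a parameter -/

lemma continuousOn_slice {a b t : ℝ} {g : ℝ → ℝ → ℝ}
    (hg : ContinuousOn (uncurry g) (Icc a b ×ˢ Ici 0)) (ht : 0 ≤ t) :
    ContinuousOn (fun x => g x t) (Icc a b) :=
  hg.comp (f := fun x => (x, t)) (by fun_prop) fun _ hx => ⟨hx, ht⟩

lemma continuousOn_uncurry_sq {g : ℝ → ℝ → ℝ} {s : Set (ℝ × ℝ)}
    (hg : ContinuousOn (uncurry g) s) : ContinuousOn (uncurry fun x t => g x t ^ 2) s :=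
  hg.pow 2

lemma continuousOn_integral_slice {a b : ℝ} (hab : a ≤ b) {g : ℝ → ℝ → ℝ}
    (hg : ContinuousOn (uncurry g) (Icc a b ×ˢ Ici 0)) :
    ContinuousOn (fun t => ∫ x in a..b, g x t) (Ici 0) := by
  have hG : Continuous (uncurry fun t x : ℝ => g (max a (min b x)) (max 0 t)) :=
    hg.comp_continuous (f := fun p : ℝ × ℝ => (max a (min b p.2), max 0 p.1)) (by fun_prop)
      fun p => ⟨⟨le_max_left _ _, max_le hab (min_le_left _ _)⟩, mem_Ici.2 (le_max_left _ _)⟩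
  refine (intervalIntegral.continuous_parametric_intervalIntegral_of_continuous'
    (μ := volume) hG a b).continuousOn.congr fun t ht => ?_
  refine intervalIntegral.integral_congr fun x hx => ?_
  rw [uIcc_of_le hab] at hx
  simp [min_eq_right hx.2, max_eq_right hx.1, max_eq_right (mem_Ici.1 ht)]

/-- If the increments of `Q` are integrals of increments of `u` against a continuous weight `w`,
then `Q` may be differentiated under the integral sign. -/
lemma hasDerivAt_of_sub_eq_integral {a b s : ℝ} (hab : a ≤ b) (hs : 0 < s)
    {u w : ℝ → ℝ → ℝ} {Q : ℝ → ℝ}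
    (hdu : ∀ x ∈ Icc a b, ∀ t ∈ Ici (0 : ℝ), DifferentiableAt ℝ (fun r => u x r) t)
    (hu : ContinuousOn (uncurry u) (Icc a b ×ˢ Ici 0))
    (hut : ContinuousOn (uncurry (pdt u)) (Icc a b ×ˢ Ici 0))
    (hw : ContinuousOn (uncurry w) (Icc a b ×ˢ Ici 0))
    (hQ : ∀ t, 0 < t → Q t - Q s = ∫ x in a..b, (u x t - u x s) * w x t) :
    HasDerivAt Q (∫ x in a..b, pdt u x s * w x s) s := by
  rw [hasDerivAt_iff_tendsto_slope]
  have hpos : ∀ᶠ t in nhdsWithin s {s}ᶜ, t ∈ Icc (s / 2) (2 * s) :=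
    nhdsWithin_le_nhds (Icc_mem_nhds (by linarith) (by linarith))
  have hsub : Icc a b ×ˢ Icc (s / 2) (2 * s) ⊆ Icc a b ×ˢ Ici (0 : ℝ) :=
    prod_mono le_rfl fun t ht => le_trans (by linarith) ht.1
  have hK : IsCompact (Icc a b ×ˢ Icc (s / 2) (2 * s)) := isCompact_Icc.prod isCompact_Icc
  obtain ⟨M₁, hM₁⟩ := hK.exists_bound_of_continuousOn (hut.mono hsub)
  obtain ⟨M₂, hM₂⟩ := hK.exists_bound_of_continuousOn (hw.mono hsub)
  have hsI : s ∈ Icc (s / 2) (2 * s) := ⟨by linarith, by linarith⟩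
  have hslope : ∀ᶠ t in nhdsWithin s {s}ᶜ,
      (∫ x in a..b, slope (fun r => u x r) s t * w x t) = slope Q s t := by
    filter_upwards [hpos] with t ht
    rw [slope_def_field, hQ t (by linarith [ht.1]), ← intervalIntegral.integral_div]
    refine intervalIntegral.integral_congr fun x _ => ?_
    simp only [slope_def_field]
    ring
  refine Tendsto.congr' hslope ?_
  refine intervalIntegral.tendsto_integral_filter_of_dominated_convergence
    (fun _ => M₁ * M₂) ?_ ?_ (by simp) ?_
  · filter_upwards [hpos] with t ht
    rw [uIoc_of_le hab]
    have ht0 : 0 ≤ t := by linarith [ht.1]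
    refine (ContinuousOn.mono ?_ Ioc_subset_Icc_self).aestronglyMeasurable measurableSet_Ioc
    simp only [slope_def_field]
    exact (((continuousOn_slice hu ht0).sub (continuousOn_slice hu hs.le)).div_const _).mul
      (continuousOn_slice hw ht0)
  · filter_upwards [hpos, self_mem_nhdsWithin] with t ht hts
    refine Eventually.of_forall fun x hx => ?_
    rw [uIoc_of_le hab] at hx
    have hx' : x ∈ Icc a b := Ioc_subset_Icc_self hx
    rw [norm_mul]
    have h₂ := hM₂ (x, t) ⟨hx', ht⟩
    have h₁ : ‖slope (fun r => u x r) s t‖ ≤ M₁ := by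
      have := (convex_Icc (s / 2) (2 * s)).norm_image_sub_le_of_norm_deriv_le
        (f := fun r => u x r) (C := M₁)
        (fun r hr => hdu x hx' r (hsub (mk_mem_prod hx' hr)).2)
        (fun r hr => hM₁ (x, r) ⟨hx', hr⟩) hsI ht
      rw [slope_def_field, norm_div]
      exact (div_le_iff₀ (norm_pos_iff.2 (sub_ne_zero.2 hts))).2 this
    exact mul_le_mul h₁ h₂ (norm_nonneg _) ((norm_nonneg _).trans h₁)
  · refine Eventually.of_forall fun x hx => ?_
    rw [uIoc_of_le hab] at hx
    have hx' : x ∈ Icc a b := Ioc_subset_Icc_self hx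
    refine Tendsto.mul ?_ ?_
    · exact hasDerivAt_iff_tendsto_slope.1 (hdu x hx' s hs.le).hasDerivAt
    · have h : ContinuousOn (fun t => w x t) (Ici 0) :=
        hw.comp (f := fun t => (x, t)) (by fun_prop) fun _ ht => ⟨hx', ht⟩
      exact (h.continuousAt (Ici_mem_nhds hs)).tendsto.mono_left nhdsWithin_le_nhds

lemma hasDerivAt_integral_sq {a b s : ℝ} (hab : a ≤ b) (hs : 0 < s) {u : ℝ → ℝ → ℝ}
    (hdu : ∀ x ∈ Icc a b, ∀ t ∈ Ici (0 : ℝ), DifferentiableAt ℝ (fun r => u x r) t)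
    (hu : ContinuousOn (uncurry u) (Icc a b ×ˢ Ici 0))
    (hut : ContinuousOn (uncurry (pdt u)) (Icc a b ×ˢ Ici 0)) :
    HasDerivAt (fun t => ∫ x in a..b, u x t ^ 2) (∫ x in a..b, pdt u x s * (2 * u x s)) s := by
  have hw : ContinuousOn (uncurry fun x t => u x t + u x s) (Icc a b ×ˢ Ici 0) :=
    hu.add (hu.comp (f := fun p : ℝ × ℝ => (p.1, s)) (by fun_prop) fun p hp => ⟨hp.1, hs.le⟩)
  simp only [two_mul]
  refine hasDerivAt_of_sub_eq_integral hab hs hdu hu hut hw fun t ht => ?_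
  rw [← intervalIntegral.integral_sub
    (((continuousOn_slice hu ht.le).fun_pow 2).intervalIntegrable_of_Icc hab)
    (((continuousOn_slice hu hs.le).fun_pow 2).intervalIntegrable_of_Icc hab)]
  exact intervalIntegral.integral_congr fun x _ => by ring

lemma hasDerivAt_integral_slice {a b s : ℝ} (hab : a ≤ b) (hs : 0 < s) {u : ℝ → ℝ → ℝ}
    (hdu : ∀ x ∈ Icc a b, ∀ t ∈ Ici (0 : ℝ), DifferentiableAt ℝ (fun r => u x r) t)
    (hu : ContinuousOn (uncurry u) (Icc a b ×ˢ Ici 0))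
    (hut : ContinuousOn (uncurry (pdt u)) (Icc a b ×ˢ Ici 0)) :
    HasDerivAt (fun t => ∫ x in a..b, u x t) (∫ x in a..b, pdt u x s) s := by
  have := hasDerivAt_of_sub_eq_integral (w := fun _ _ => 1) (Q := fun t => ∫ x in a..b, u x t)
    hab hs hdu hu hut continuousOn_const fun t ht => ?_
  · simpa using this
  · rw [← intervalIntegral.integral_sub
      ((continuousOn_slice hu ht.le).intervalIntegrable_of_Icc hab)
      ((continuousOn_slice hu hs.le).intervalIntegrable_of_Icc hab)]
    simp

/-- Time derivative of the Dirichlet integral of a function vanishing on the boundary; no mixed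
derivative is needed. -/
lemma hasDerivAt_integral_pdx_sq {a b s : ℝ} (hab : a ≤ b) (hs : 0 < s) {u : ℝ → ℝ → ℝ}
    (hdu : ∀ x ∈ Icc a b, ∀ t ∈ Ici (0 : ℝ), DifferentiableAt ℝ (fun r => u x r) t)
    (hu : ContinuousOn (uncurry u) (Icc a b ×ˢ Ici 0))
    (hut : ContinuousOn (uncurry (pdt u)) (Icc a b ×ˢ Ici 0))
    (hux : ContinuousOn (uncurry (pdx u)) (Icc a b ×ˢ Ici 0))
    (huxx : ContinuousOn (uncurry (pdx (pdx u))) (Icc a b ×ˢ Ici 0))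
    (hd₀ : ∀ x ∈ Icc a b, ∀ t, 0 ≤ t → HasDerivAt (fun y => u y t) (pdx u x t) x)
    (hd₁ : ∀ x ∈ Icc a b, ∀ t, 0 ≤ t → HasDerivAt (fun y => pdx u y t) (pdx (pdx u) x t) x)
    (hbc : ∀ t, 0 < t → u a t = 0 ∧ u b t = 0) :
    HasDerivAt (fun t => ∫ x in a..b, pdx u x t ^ 2)
      (∫ x in a..b, pdt u x s * (-(2 * pdx (pdx u) x s))) s := by
  have hw : ContinuousOn (uncurry fun x t => -(pdx (pdx u) x t + pdx (pdx u) x s))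
      (Icc a b ×ˢ Ici 0) :=
    (huxx.add (huxx.comp (f := fun p : ℝ × ℝ => (p.1, s)) (by fun_prop)
      fun p hp => ⟨hp.1, hs.le⟩)).neg
  simp only [two_mul]
  refine hasDerivAt_of_sub_eq_integral hab hs hdu hu hut hw fun t ht => ?_
  have cx := fun r (hr : 0 < r) => continuousOn_slice hux hr.le
  have cu := fun r (hr : 0 < r) => continuousOn_slice hu hr.le
  have cw := continuousOn_slice hw ht.le
  have i₁ := ((cx t ht).fun_pow 2).intervalIntegrable_of_Icc (μ := volume) hab
  have i₂ := ((cx s hs).fun_pow 2).intervalIntegrable_of_Icc (μ := volume) hab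
  have i₃ := (((cu t ht).fun_sub (cu s hs)).fun_mul cw).intervalIntegrable_of_Icc (μ := volume) hab
  have key := intervalIntegral.integral_eq_sub_of_hasDerivAt (a := a) (b := b)
    (f := fun x => (u x t - u x s) * (pdx u x t + pdx u x s))
    (f' := fun x => (pdx u x t ^ 2 - pdx u x s ^ 2)
      - (u x t - u x s) * (-(pdx (pdx u) x t + pdx (pdx u) x s)))
    (fun x hx => by
      rw [uIcc_of_le hab] at hx
      refine (((hd₀ x hx t ht.le).sub (hd₀ x hx s hs.le)).mul
        ((hd₁ x hx t ht.le).add (hd₁ x hx s hs.le))).congr_deriv ?_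
      simp only [Pi.sub_apply, Pi.add_apply]
      ring)
    ((i₁.sub i₂).sub i₃)
  rw [(hbc t ht).1, (hbc t ht).2, (hbc s hs).1, (hbc s hs).2,
    intervalIntegral.integral_sub (i₁.sub i₂) i₃, intervalIntegral.integral_sub i₁ i₂] at key
  linarith

/-- Integrating a pointwise bound modulo a total derivative with vanishing boundary values. -/
lemma integral_le_integral_of_le_add_deriv {a b : ℝ} (hab : a ≤ b) {g h J J' : ℝ → ℝ}
    (hg : ContinuousOn g (Icc a b)) (hh : ContinuousOn h (Icc a b))
    (hJ' : ContinuousOn J' (Icc a b)) (hJ : ∀ x ∈ Icc a b, HasDerivAt J (J' x) x)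
    (ha : J a = 0) (hb : J b = 0) (hle : ∀ x ∈ Ioo a b, g x ≤ h x + J' x) :
    ∫ x in a..b, g x ≤ ∫ x in a..b, h x := by
  have iJ := hJ'.intervalIntegrable_of_Icc (μ := volume) hab
  have ih := hh.intervalIntegrable_of_Icc (μ := volume) hab
  have key := intervalIntegral.integral_eq_sub_of_hasDerivAt
    (fun x hx => hJ x (by rwa [uIcc_of_le hab] at hx)) iJ
  have hm := intervalIntegral.integral_mono_on_of_le_Ioo hab
    (hg.intervalIntegrable_of_Icc (μ := volume) hab) (ih.add iJ) hle
  rw [intervalIntegral.integral_add ih iJ, key, ha, hb] at hm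
  linarith

/-- Gagliardo–Nirenberg type bound of the supremum by the mass and the Dirichlet integral. -/
lemma sq_le_mass_add_dirichlet {a b m δ : ℝ} (hab : a < b) (hδ : 0 < δ) {θ θ' : ℝ → ℝ}
    (hd : ∀ x ∈ Icc a b, HasDerivAt θ (θ' x) x) (hc : ContinuousOn θ' (Icc a b))
    (hpos : ∀ x ∈ Icc a b, 0 < θ x) (hm : ∫ x in a..b, θ x ≤ m) {z : ℝ} (hz : z ∈ Icc a b) :
    θ z ^ 2 ≤ 2 * (m / (b - a)) ^ 2 + 2 * δ * (∫ x in a..b, θ' x ^ 2) + m ^ 2 / δ ^ 2 := by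
  have hθ : ContinuousOn θ (Icc a b) := fun x hx => (hd x hx).continuousAt.continuousWithinAt
  have hne : (Icc a b).Nonempty := nonempty_Icc.2 hab.le
  obtain ⟨x, hx, hxmax⟩ := isCompact_Icc.exists_isMaxOn hne hθ
  obtain ⟨y, hy, hymin⟩ := isCompact_Icc.exists_isMinOn hne hθ
  have hmin : θ y ≤ m / (b - a) := by
    rw [le_div_iff₀ (sub_pos.2 hab)]
    have := intervalIntegral.integral_mono_on hab.le (intervalIntegrable_const (c := θ y))
      (hθ.intervalIntegrable_of_Icc (μ := volume) hab.le) fun w hw => hymin hw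
    rw [intervalIntegral.integral_const, smul_eq_mul] at this
    linarith
  set D := ∫ x in a..b, θ' x ^ 2
  have hsub : uIcc y x ⊆ Icc a b := (convex_Icc a b).ordConnected.uIcc_subset hy hx
  have hc2 : ContinuousOn (fun w => 2 * θ w * θ' w) (Icc a b) :=
    (continuousOn_const.mul hθ).mul hc
  have hftc : ∫ w in y..x, 2 * θ w * θ' w = θ x ^ 2 - θ y ^ 2 :=
    intervalIntegral.integral_eq_sub_of_hasDerivAt (f := fun w => θ w ^ 2)
      (fun w hw => by simpa using (hd w (hsub hw)).fun_pow 2) (hc2.mono hsub).intervalIntegrable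
  have iD := (hc.fun_pow 2).intervalIntegrable_of_Icc (μ := volume) hab.le
  have iθ := hθ.intervalIntegrable_of_Icc (μ := volume) hab.le
  have habs : ∫ w in y..x, 2 * θ w * θ' w ≤ ∫ w in a..b, |2 * θ w * θ' w| := by
    refine (le_abs_self _).trans ?_
    refine (intervalIntegral.norm_integral_le_integral_norm_uIoc
      (f := fun w => 2 * θ w * θ' w)).trans ?_
    rw [intervalIntegral.integral_of_le hab.le]
    refine setIntegral_mono_set (hc2.abs.integrableOn_Icc.mono_set Ioc_subset_Icc_self)
      (Eventually.of_forall fun _ => abs_nonneg _) (LE.le.eventuallyLE ?_)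
    exact Ioc_subset_Ioc (le_min hy.1 hx.1) (max_le hy.2 hx.2)
  have hyoung : ∫ w in a..b, |2 * θ w * θ' w| ≤ ∫ w in a..b, (δ * θ' w ^ 2 + θ x / δ * θ w) := by
    refine intervalIntegral.integral_mono_on hab.le
      (hc2.abs.intervalIntegrable_of_Icc hab.le) ((iD.const_mul δ).add (iθ.const_mul _))
      fun w hw => ?_
    have h₁ : θ w ^ 2 / δ ≤ θ x / δ * θ w := by
      rw [div_mul_eq_mul_div, sq]
      have := hxmax hw
      have := hpos w hw
      gcongr
      assumption
    have h₂ : 2 * (|θ w| * |θ' w|) ≤ δ * θ' w ^ 2 + θ w ^ 2 / δ := by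
      have : δ * θ' w ^ 2 + θ w ^ 2 / δ - 2 * (|θ w| * |θ' w|)
          = (δ * |θ' w| - |θ w|) ^ 2 / δ := by
        rw [← sq_abs (θ' w), ← sq_abs (θ w)]
        field_simp
        ring
      have : 0 ≤ (δ * |θ' w| - |θ w|) ^ 2 / δ := by positivity
      linarith
    rw [abs_mul, abs_mul, abs_two]
    linarith
  rw [intervalIntegral.integral_add (iD.const_mul δ) (iθ.const_mul _),
    intervalIntegral.integral_const_mul, intervalIntegral.integral_const_mul] at hyoung
  have hx0 := hpos x hx
  have hy0 := hpos y hy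
  have hlast : θ x / δ * ∫ w in a..b, θ w ≤ θ x ^ 2 / 2 + (m / δ) ^ 2 / 2 := by
    have h₁ : θ x / δ * ∫ w in a..b, θ w ≤ θ x / δ * m := by gcongr
    have h₂ : θ x / δ * m = θ x * (m / δ) := by ring
    nlinarith [sq_nonneg (θ x - m / δ)]
  have hzx : θ z ^ 2 ≤ θ x ^ 2 := by
    have := hpos z hz
    have : θ z ≤ θ x := hxmax hz
    gcongr
  have hyy : θ y ^ 2 ≤ (m / (b - a)) ^ 2 := by gcongr
  rw [← div_pow]
  linarith

/-! ### Estimates for the regularized problem -/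

lemma HypF.hasDerivAt {f f' f'' : ℝ → ℝ} (hf : HypF f f' f'') {x : ℝ} (hx : 0 < x) :
    HasDerivAt f (f' x) x :=
  (hf.hasDeriv₁ x hx.le).hasDerivAt (Ici_mem_nhds hx)

lemma HypF.continuousOn_deriv {f f' f'' : ℝ → ℝ} (hf : HypF f f' f'') :
    ContinuousOn f' (Ici 0) :=
  fun x hx => (hf.hasDeriv₂ x hx).continuousWithinAt

lemma HypF.abs_le {f f' f'' : ℝ → ℝ} (hf : HypF f f' f'') {M : ℝ}
    (hM : ∀ x ∈ Ici (0 : ℝ), |f' x| ≤ M) {x : ℝ} (hx : 0 ≤ x) : |f x| ≤ M * x := by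
  have := (convex_Ici (0 : ℝ)).norm_image_sub_le_of_norm_hasDerivWithin_le
    hf.hasDeriv₁ hM (mem_Ici.2 le_rfl) (mem_Ici.2 hx)
  simpa [hf.zero, abs_of_nonneg hx] using this

namespace IsClassicalSolEps

variable {a b ε : ℝ} {f f' f'' v0 u0 Θ0 : ℝ → ℝ} {v u Θ : ℝ → ℝ → ℝ}

lemma hasDerivAt_v (h : IsClassicalSolEps a b f ε v0 u0 Θ0 v u Θ) {k : ℕ} (hk : k < 4) {x t : ℝ}
    (hx : x ∈ Icc a b) (ht : 0 ≤ t) :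
    HasDerivAt (fun y => pdx^[k] v y t) (pdx^[k + 1] v x t) x := by
  rw [iterate_succ_apply']
  exact (h.diffx_v k hk x hx t ht).hasDerivAt

lemma hasDerivAt_u (h : IsClassicalSolEps a b f ε v0 u0 Θ0 v u Θ) {k : ℕ} (hk : k < 2) {x t : ℝ}
    (hx : x ∈ Icc a b) (ht : 0 ≤ t) :
    HasDerivAt (fun y => pdx^[k] u y t) (pdx^[k + 1] u x t) x := by
  rw [iterate_succ_apply']
  exact (h.diffx_u k hk x hx t ht).hasDerivAt

lemma hasDerivAt_Θ (h : IsClassicalSolEps a b f ε v0 u0 Θ0 v u Θ) {k : ℕ} (hk : k < 2) {x t : ℝ}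
    (hx : x ∈ Icc a b) (ht : 0 ≤ t) :
    HasDerivAt (fun y => pdx^[k] Θ y t) (pdx^[k + 1] Θ x t) x := by
  rw [iterate_succ_apply']
  exact (h.diffx_Θ k hk x hx t ht).hasDerivAt

lemma hasDerivAt_comp_Θ (hf : HypF f f' f'') (h : IsClassicalSolEps a b f ε v0 u0 Θ0 v u Θ)
    {x t : ℝ} (hx : x ∈ Icc a b) (ht : 0 ≤ t) :
    HasDerivAt (fun y => f (Θ y t)) (f' (Θ x t) * pdx Θ x t) x :=
  (hf.hasDerivAt (h.Θ_pos x hx t ht)).comp x (h.hasDerivAt_Θ (k := 0) (by norm_num) hx ht)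

/-- The energy of a solution at time `t`. -/
def energy (a b : ℝ) (v u Θ : ℝ → ℝ → ℝ) (t : ℝ) : ℝ :=
  1 / 2 * (∫ x in a..b, v x t ^ 2) + 1 / 2 * (∫ x in a..b, pdx u x t ^ 2) + ∫ x in a..b, Θ x t

lemma antitoneOn_energy (hab : a < b) (hε : 0 < ε) (hf : HypF f f' f'')
    (h : IsClassicalSolEps a b f ε v0 u0 Θ0 v u Θ) :
    AntitoneOn (energy a b v u Θ) (Ici 0) := by
  have cv : ∀ k ≤ 4, ∀ t, 0 ≤ t → ContinuousOn (fun x => pdx^[k] v x t) (Icc a b) :=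
    fun k hk t ht => continuousOn_slice (h.cont_v k hk) ht
  have cu : ∀ k ≤ 2, ∀ t, 0 ≤ t → ContinuousOn (fun x => pdx^[k] u x t) (Icc a b) :=
    fun k hk t ht => continuousOn_slice (h.cont_u k hk) ht
  have cΘ : ∀ k ≤ 2, ∀ t, 0 ≤ t → ContinuousOn (fun x => pdx^[k] Θ x t) (Icc a b) :=
    fun k hk t ht => continuousOn_slice (h.cont_Θ k hk) ht
  have hder : ∀ t, 0 < t → HasDerivAt (energy a b v u Θ)
      (1 / 2 * (∫ x in a..b, pdt v x t * (2 * v x t))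
        + 1 / 2 * (∫ x in a..b, pdt u x t * (-(2 * pdx (pdx u) x t)))
        + ∫ x in a..b, pdt Θ x t) t := fun t ht =>
    (((hasDerivAt_integral_sq hab.le ht h.difft_v (h.cont_v 0 (by norm_num)) h.contt_v).const_mul
      _).add ((hasDerivAt_integral_pdx_sq hab.le ht h.difft_u (h.cont_u 0 (by norm_num)) h.contt_u
        (h.cont_u 1 (by norm_num)) (h.cont_u 2 (by norm_num))
        (fun x hx t ht => h.hasDerivAt_u (k := 0) (by norm_num) hx ht)
        (fun x hx t ht => h.hasDerivAt_u (k := 1) (by norm_num) hx ht) h.bc_u).const_mul _)).add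
      (hasDerivAt_integral_slice hab.le ht h.difft_Θ (h.cont_Θ 0 (by norm_num)) h.contt_Θ)
  refine antitoneOn_of_deriv_nonpos (convex_Ici 0) ?_ ?_ ?_
  · exact (((continuousOn_integral_slice (g := fun x t => v x t ^ 2) hab.le
      (continuousOn_uncurry_sq (h.cont_v 0 (by norm_num)))).const_smul (1 / 2 : ℝ)).add
        ((continuousOn_integral_slice (g := fun x t => pdx u x t ^ 2) hab.le
          (continuousOn_uncurry_sq (h.cont_u 1 (by norm_num)))).const_smul (1 / 2 : ℝ))).add
      (continuousOn_integral_slice hab.le (h.cont_Θ 0 (by norm_num)))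
  · rw [interior_Ici]
    exact fun t ht => (hder t ht).differentiableAt.differentiableWithinAt
  rw [interior_Ici]
  intro t ht
  have ht : 0 < t := ht
  rw [(hder t ht).deriv]
  have c₁ : ContinuousOn (fun x => pdt v x t * (2 * v x t)) (Icc a b) :=
    (continuousOn_slice h.contt_v ht.le).mul (continuousOn_const.mul (cv 0 (by norm_num) t ht.le))
  have c₂ : ContinuousOn (fun x => pdt u x t * (-(2 * pdx (pdx u) x t))) (Icc a b) :=
    (continuousOn_slice h.contt_u ht.le).mul
      (continuousOn_const.mul (cu 2 (by norm_num) t ht.le)).neg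
  have c₃ : ContinuousOn (fun x => pdt Θ x t) (Icc a b) := continuousOn_slice h.contt_Θ ht.le
  have cf : ContinuousOn (fun x => f (Θ x t)) (Icc a b) := fun x hx =>
    (h.hasDerivAt_comp_Θ hf hx ht.le).continuousAt.continuousWithinAt
  have cf' : ContinuousOn (fun x => f' (Θ x t)) (Icc a b) :=
    hf.continuousOn_deriv.comp (cΘ 0 (by norm_num) t ht.le) fun x hx => (h.Θ_pos x hx t ht.le).le
  obtain ⟨hva, hvb, hvva, hvvb⟩ := h.bc_v t ht
  obtain ⟨hΘa, hΘb⟩ := h.bc_Θ t ht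
  have key := integral_le_integral_of_le_add_deriv hab.le
    (g := fun x => 1 / 2 * (pdt v x t * (2 * v x t))
      + 1 / 2 * (pdt u x t * (-(2 * pdx (pdx u) x t))) + pdt Θ x t)
    (h := fun _ => 0)
    (J := fun x => -ε * (pdx^[3] v x t * pdx^[0] v x t - pdx^[2] v x t * pdx^[1] v x t)
      + pdx^[1] Θ x t - f (Θ x t) * pdx^[0] v x t)
    (J' := fun x => -ε * ((pdx^[4] v x t * pdx^[0] v x t + pdx^[3] v x t * pdx^[1] v x t)
        - (pdx^[3] v x t * pdx^[1] v x t + pdx^[2] v x t * pdx^[2] v x t))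
      + pdx^[2] Θ x t - (f' (Θ x t) * pdx^[1] Θ x t * pdx^[0] v x t + f (Θ x t) * pdx^[1] v x t))
    (((continuousOn_const.mul c₁).add (continuousOn_const.mul c₂)).add c₃) continuousOn_const
    ?_ ?_ ?_ ?_ ?_
  · have e := fun c : ℝ => intervalIntegral.integral_const_mul (a := a) (b := b) (μ := volume) c
    have i₁ := c₁.intervalIntegrable_of_Icc (μ := volume) hab.le
    have i₂ := c₂.intervalIntegrable_of_Icc (μ := volume) hab.le
    have i₃ := c₃.intervalIntegrable_of_Icc (μ := volume) hab.le
    rw [intervalIntegral.integral_add ((i₁.const_mul _).add (i₂.const_mul _)) i₃,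
      intervalIntegral.integral_add (i₁.const_mul _) (i₂.const_mul _), e, e] at key
    simpa using key
  · have hv := fun k hk => cv k hk t ht.le
    have hv0 := hv 0 (by norm_num)
    have hv1 := hv 1 (by norm_num)
    have hv2 := hv 2 (by norm_num)
    have hv3 := hv 3 (by norm_num)
    exact ((continuousOn_const.mul ((((hv 4 le_rfl).mul hv0).add (hv3.mul hv1)).sub
      ((hv3.mul hv1).add (hv2.mul hv2)))).add (cΘ 2 le_rfl t ht.le)).sub
      (((cf'.mul (cΘ 1 (by norm_num) t ht.le)).mul hv0).add (cf.mul hv1))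
  · intro x hx
    have d := fun (k : ℕ) (hk : k < 4) => h.hasDerivAt_v hk hx ht.le
    exact (((((d 3 (by norm_num)).mul (d 0 (by norm_num))).sub
      ((d 2 (by norm_num)).mul (d 1 (by norm_num)))).const_mul (-ε)).add
      (h.hasDerivAt_Θ (k := 1) (by norm_num) hx ht.le)).sub
      ((h.hasDerivAt_comp_Θ hf hx ht.le).mul (d 0 (by norm_num)))
  · simp only [iterate_zero, id, hva, hvva, iterate_one, hΘa]
    ring
  · simp only [iterate_zero, id, hvb, hvvb, iterate_one, hΘb]
    ring
  · intro x hx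
    have hfx : pdx (fun y s => f (Θ y s)) x t = f' (Θ x t) * pdx Θ x t :=
      (h.hasDerivAt_comp_Θ hf (Ioo_subset_Icc_self hx) ht.le).deriv
    simp only [h.eq_v x hx t ht, h.eq_u x hx t ht, h.eq_Θ x hx t ht, hfx]
    change _ ≤ 0 + (-ε * ((pdx^[4] v x t * v x t + pdx^[3] v x t * pdx v x t)
        - (pdx^[3] v x t * pdx v x t + pdx^[2] v x t * pdx^[2] v x t))
      + pdx^[2] Θ x t - (f' (Θ x t) * pdx Θ x t * v x t + f (Θ x t) * pdx v x t))
    change 1 / 2 * (_ * (2 * v x t)) + 1 / 2 * (_ * (-(2 * pdx^[2] u x t))) + _ ≤ _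
    nlinarith [mul_nonneg hε.le (sq_nonneg (pdx^[2] v x t)),
      mul_nonneg hε.le (sq_nonneg (pdx^[2] u x t))]

lemma energy_zero (hab : a < b) (h : IsClassicalSolEps a b f ε v0 u0 Θ0 v u Θ) :
    energy a b v u Θ 0 = 1 / 2 * (∫ x in Ioo a b, v0 x ^ 2)
      + 1 / 2 * (∫ x in Ioo a b, deriv u0 x ^ 2) + ∫ x in Ioo a b, Θ0 x := by
  simp only [energy, intervalIntegral.integral_of_le hab.le, integral_Ioc_eq_integral_Ioo]
  congr 1
  · congr 2
    · refine setIntegral_congr_fun measurableSet_Ioo fun x hx => ?_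
      simp only [(h.init x (Ioo_subset_Icc_self hx)).1]
    · refine setIntegral_congr_fun measurableSet_Ioo fun x hx => ?_
      have : (fun y => u y 0) =ᶠ[nhds x] u0 := by
        filter_upwards [isOpen_Ioo.mem_nhds hx] with y hy
        exact (h.init y (Ioo_subset_Icc_self hy)).2.1
      simp only [pdx, this.deriv_eq]
  · refine setIntegral_congr_fun measurableSet_Ioo fun x hx => ?_
    exact (h.init x (Ioo_subset_Icc_self hx)).2.2

lemma integral_Θ_nonneg (hab : a < b) (h : IsClassicalSolEps a b f ε v0 u0 Θ0 v u Θ) {t : ℝ}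
    (ht : 0 ≤ t) : 0 ≤ ∫ x in a..b, Θ x t :=
  intervalIntegral.integral_nonneg hab.le fun x hx => (h.Θ_pos x hx t ht).le

lemma integral_v_sq_le (hab : a < b) (h : IsClassicalSolEps a b f ε v0 u0 Θ0 v u Θ) {t : ℝ}
    (ht : 0 ≤ t) : ∫ x in a..b, v x t ^ 2 ≤ 2 * energy a b v u Θ t := by
  have : 0 ≤ ∫ x in a..b, pdx u x t ^ 2 :=
    intervalIntegral.integral_nonneg hab.le fun x _ => sq_nonneg _
  have := h.integral_Θ_nonneg hab ht
  rw [energy]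
  linarith

lemma integral_Θ_le_energy (hab : a < b) (v u Θ : ℝ → ℝ → ℝ) (t : ℝ) :
    ∫ x in a..b, Θ x t ≤ energy a b v u Θ t := by
  have : 0 ≤ ∫ x in a..b, pdx u x t ^ 2 :=
    intervalIntegral.integral_nonneg hab.le fun x _ => sq_nonneg _
  have : 0 ≤ ∫ x in a..b, v x t ^ 2 :=
    intervalIntegral.integral_nonneg hab.le fun x _ => sq_nonneg _
  rw [energy]
  linarith

/-- Differential inequality for `∫ Θ²`, given a bound `m` on the energy. -/
lemma integral_pdt_Θ_mul_le (hab : a < b) (hf : HypF f f' f'')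
    (h : IsClassicalSolEps a b f ε v0 u0 Θ0 v u Θ) {M m δ t : ℝ}
    (hM : ∀ x ∈ Ici (0 : ℝ), |f' x| ≤ M) (hδ : 0 < δ) (hδm : 32 * M ^ 2 * m * δ ≤ 1) (ht : 0 < t)
    (hm : energy a b v u Θ t ≤ m) :
    ∫ x in a..b, pdt Θ x t * (2 * Θ x t) ≤ -(1 / 2) * (∫ x in a..b, pdx Θ x t ^ 2)
      + 8 * M ^ 2 * m * (2 * (m / (b - a)) ^ 2 + m ^ 2 / δ ^ 2) := by
  have cv : ∀ k ≤ 4, ContinuousOn (fun x => pdx^[k] v x t) (Icc a b) :=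
    fun k hk => continuousOn_slice (h.cont_v k hk) ht.le
  have cΘ : ∀ k ≤ 2, ContinuousOn (fun x => pdx^[k] Θ x t) (Icc a b) :=
    fun k hk => continuousOn_slice (h.cont_Θ k hk) ht.le
  have cf : ContinuousOn (fun x => f (Θ x t)) (Icc a b) := fun x hx =>
    (h.hasDerivAt_comp_Θ hf hx ht.le).continuousAt.continuousWithinAt
  have cf' : ContinuousOn (fun x => f' (Θ x t)) (Icc a b) :=
    hf.continuousOn_deriv.comp (cΘ 0 (by norm_num)) fun x hx => (h.Θ_pos x hx t ht.le).le
  obtain ⟨hva, hvb, -⟩ := h.bc_v t ht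
  obtain ⟨hΘa, hΘb⟩ := h.bc_Θ t ht
  have hv0 := cv 0 (by norm_num)
  have hv1 := cv 1 (by norm_num)
  have hΘ0 : ContinuousOn (fun x => Θ x t) (Icc a b) := cΘ 0 (by norm_num)
  have hΘ1 := cΘ 1 (by norm_num)
  have hΘ2 := cΘ 2 (by norm_num)
  set D := ∫ x in a..b, pdx Θ x t ^ 2
  set S := 2 * (m / (b - a)) ^ 2 + 2 * δ * D + m ^ 2 / δ ^ 2
  have hS : ∀ x ∈ Icc a b, Θ x t ^ 2 ≤ S := fun x hx =>
    sq_le_mass_add_dirichlet hab hδ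
      (fun y hy => h.hasDerivAt_Θ (k := 0) (by norm_num) hy ht.le) hΘ1
      (fun y hy => h.Θ_pos y hy t ht.le) ((integral_Θ_le_energy hab v u Θ t).trans hm) hx
  have hD : 0 ≤ D := intervalIntegral.integral_nonneg hab.le fun x _ => sq_nonneg _
  have hm0 : 0 ≤ m := (h.integral_Θ_nonneg hab ht.le).trans
    ((integral_Θ_le_energy hab v u Θ t).trans hm)
  have hS0 : 0 ≤ S := by positivity
  have key := integral_le_integral_of_le_add_deriv hab.le
    (g := fun x => pdt Θ x t * (2 * Θ x t))
    (h := fun x => -(pdx^[1] Θ x t ^ 2) + 4 * M ^ 2 * S * pdx^[0] v x t ^ 2)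
    (J := fun x => 2 * (pdx^[1] Θ x t * pdx^[0] Θ x t
      - f (Θ x t) * pdx^[0] Θ x t * pdx^[0] v x t))
    (J' := fun x => 2 * (pdx^[2] Θ x t * pdx^[0] Θ x t + pdx^[1] Θ x t * pdx^[1] Θ x t
      - ((f' (Θ x t) * pdx^[1] Θ x t * pdx^[0] Θ x t + f (Θ x t) * pdx^[1] Θ x t) * pdx^[0] v x t
        + f (Θ x t) * pdx^[0] Θ x t * pdx^[1] v x t)))
    ((continuousOn_slice h.contt_Θ ht.le).mul (continuousOn_const.mul hΘ0)) (by fun_prop)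
    ?_ ?_ ?_ ?_ ?_
  · refine key.trans ?_
    have iD := (hΘ1.fun_pow 2).intervalIntegrable_of_Icc (μ := volume) hab.le
    have iv := (hv0.fun_pow 2).intervalIntegrable_of_Icc (μ := volume) hab.le
    have iD' : IntervalIntegrable (fun x => -(pdx^[1] Θ x t ^ 2)) volume a b := iD.neg
    rw [intervalIntegral.integral_add iD' (iv.const_mul _), intervalIntegral.integral_neg,
      intervalIntegral.integral_const_mul]
    change -D + 4 * M ^ 2 * S * (∫ x in a..b, v x t ^ 2) ≤ _
    have hV : ∫ x in a..b, v x t ^ 2 ≤ 2 * m := by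
      linarith [h.integral_v_sq_le hab ht.le]
    have h₁ : 4 * M ^ 2 * S * (∫ x in a..b, v x t ^ 2) ≤ 4 * M ^ 2 * S * (2 * m) := by gcongr
    have h₂ : 32 * M ^ 2 * m * δ * D ≤ 1 * D := by gcongr
    simp only [S] at h₁
    linarith
  · exact continuousOn_const.mul (((hΘ2.mul hΘ0).add (hΘ1.mul hΘ1)).sub
      (((((cf'.mul hΘ1).mul hΘ0).add (cf.mul hΘ1)).mul hv0).add ((cf.mul hΘ0).mul hv1)))
  · intro x hx
    have d := fun (k : ℕ) (hk : k < 2) => h.hasDerivAt_Θ hk hx ht.le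
    exact (((d 1 (by norm_num)).mul (d 0 (by norm_num))).sub
      (((h.hasDerivAt_comp_Θ hf hx ht.le).mul (d 0 (by norm_num))).mul
        (h.hasDerivAt_v (k := 0) (by norm_num) hx ht.le))).const_mul 2
  · simp only [iterate_zero, id, hva, iterate_one, hΘa]
    ring
  · simp only [iterate_zero, id, hvb, iterate_one, hΘb]
    ring
  · intro x hx
    have hx' := Ioo_subset_Icc_self hx
    have hpos := h.Θ_pos x hx' t ht.le
    have hg : |f' (Θ x t) * Θ x t + f (Θ x t)| ≤ 2 * M * Θ x t := by
      have h₁ := hf.abs_le hM hpos.le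
      have h₂ : |f' (Θ x t) * Θ x t| ≤ M * Θ x t := by
        rw [abs_mul, abs_of_pos hpos]
        exact mul_le_mul_of_nonneg_right (hM _ hpos.le) hpos.le
      linarith [abs_add_le (f' (Θ x t) * Θ x t) (f (Θ x t))]
    have hg2 : (f' (Θ x t) * Θ x t + f (Θ x t)) ^ 2 ≤ 4 * M ^ 2 * S := by
      calc _ ≤ (2 * M * Θ x t) ^ 2 := sq_le_sq.2 (hg.trans (le_abs_self _))
        _ = 4 * M ^ 2 * Θ x t ^ 2 := by ring
        _ ≤ _ := by
          have := hS x hx'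
          gcongr
    have hg3 := mul_le_mul_of_nonneg_right hg2 (sq_nonneg (v x t))
    simp only [h.eq_Θ x hx t ht, iterate_zero, id, iterate_one]
    linarith [sq_nonneg (pdx Θ x t - (f' (Θ x t) * Θ x t + f (Θ x t)) * v x t)]

/-- Space-time bound for `Θₓ`, given a bound `m` on the initial energy. -/
lemma integral_pdx_Θ_sq_le (hab : a < b) (hε : 0 < ε) (hf : HypF f f' f'')
    (h : IsClassicalSolEps a b f ε v0 u0 Θ0 v u Θ) {M m δ T : ℝ}
    (hM : ∀ x ∈ Ici (0 : ℝ), |f' x| ≤ M) (hδ : 0 < δ) (hδm : 32 * M ^ 2 * m * δ ≤ 1) (hT : 0 ≤ T)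
    (hm : energy a b v u Θ 0 ≤ m) :
    ∫ t in (0 : ℝ)..T, ∫ x in a..b, pdx Θ x t ^ 2 ≤ 2 * ((∫ x in a..b, Θ x 0 ^ 2)
      + 8 * M ^ 2 * m * (2 * (m / (b - a)) ^ 2 + m ^ 2 / δ ^ 2) * T) := by
  set K := 8 * M ^ 2 * m * (2 * (m / (b - a)) ^ 2 + m ^ 2 / δ ^ 2)
  have hDc : ContinuousOn (fun t => ∫ x in a..b, pdx Θ x t ^ 2) (Ici 0) :=
    continuousOn_integral_slice (g := fun x t => pdx Θ x t ^ 2) hab.le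
      (continuousOn_uncurry_sq (h.cont_Θ 1 (by norm_num)))
  set D : ℝ → ℝ := fun t => ∫ x in a..b, pdx Θ x (max 0 t) ^ 2 with hD
  have hDcont : Continuous D :=
    hDc.comp_continuous (f := fun t => max 0 t) (by fun_prop) fun t => mem_Ici.2 (le_max_left _ _)
  have hDeq : ∀ t, 0 ≤ t → D t = ∫ x in a..b, pdx Θ x t ^ 2 := fun t ht => by
    simp only [hD, max_eq_right ht]
  have hprim : ∀ t, HasDerivAt (fun t => ∫ s in (0 : ℝ)..t, D s) (D t) t := fun t =>
    (hDcont.integral_hasStrictDerivAt 0 t).hasDerivAt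
  have hder : ∀ t, 0 < t → HasDerivAt
      (fun t => (∫ x in a..b, Θ x t ^ 2) + 1 / 2 * (∫ s in (0 : ℝ)..t, D s) - K * t)
      ((∫ x in a..b, pdt Θ x t * (2 * Θ x t)) + 1 / 2 * D t - K * 1) t := fun t ht =>
    ((hasDerivAt_integral_sq hab.le ht h.difft_Θ (h.cont_Θ 0 (by norm_num)) h.contt_Θ).add
      ((hprim t).const_mul _)).sub ((hasDerivAt_id t).const_mul K)
  have hanti : AntitoneOn
      (fun t => (∫ x in a..b, Θ x t ^ 2) + 1 / 2 * (∫ s in (0 : ℝ)..t, D s) - K * t)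
      (Ici 0) := by
    refine antitoneOn_of_deriv_nonpos (convex_Ici 0) ?_ ?_ ?_
    · have h₁ := continuousOn_integral_slice (g := fun x t => Θ x t ^ 2) hab.le
        (continuousOn_uncurry_sq (h.cont_Θ 0 (by norm_num)))
      have h₂ : Continuous fun t => ∫ s in (0 : ℝ)..t, D s :=
        continuous_iff_continuousAt.2 fun t => (hprim t).continuousAt
      exact (h₁.add (continuous_const.mul h₂).continuousOn).sub
        (continuous_const.mul continuous_id).continuousOn
    · rw [interior_Ici]
      exact fun t ht => (hder t ht).differentiableAt.differentiableWithinAt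
    · rw [interior_Ici]
      intro t ht
      have ht : 0 < t := ht
      rw [(hder t ht).deriv, hDeq t ht.le]
      have hE := antitoneOn_energy hab hε hf h (mem_Ici.2 le_rfl) (mem_Ici.2 ht.le) ht.le
      have := h.integral_pdt_Θ_mul_le hab hf hM hδ hδm ht (hE.trans hm)
      linarith
  have key := hanti (mem_Ici.2 le_rfl) (mem_Ici.2 hT) hT
  have hcongr : ∫ t in (0 : ℝ)..T, D t = ∫ t in (0 : ℝ)..T, ∫ x in a..b, pdx Θ x t ^ 2 :=
    intervalIntegral.integral_congr fun t ht => hDeq t (by rw [uIcc_of_le hT] at ht; exact ht.1)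
  have hpos : 0 ≤ ∫ x in a..b, Θ x T ^ 2 :=
    intervalIntegral.integral_nonneg hab.le fun x _ => sq_nonneg _
  simp only [intervalIntegral.integral_same, hcongr] at key
  linarith

end IsClassicalSolEps

lemma intOmT_eq_intervalIntegral {a b T : ℝ} (hab : a ≤ b) (hT : 0 ≤ T) {g : ℝ → ℝ → ℝ}
    (hg : ContinuousOn (uncurry g) (Icc a b ×ˢ Ici 0)) :
    intOmT a b T g = ∫ t in (0 : ℝ)..T, ∫ x in a..b, g x t := by
  have hint : IntegrableOn (uncurry g) (Ioo a b ×ˢ Ioo 0 T) (volume.prod volume) :=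
    ((hg.mono (prod_mono le_rfl Icc_subset_Ici_self)).integrableOn_compact
      (isCompact_Icc.prod isCompact_Icc)).mono_set (prod_mono Ioo_subset_Icc_self
        Ioo_subset_Icc_self)
  simp only [intOmT, intervalIntegral.integral_of_le hab, intervalIntegral.integral_of_le hT,
    integral_Ioc_eq_integral_Ioo]
  rw [IntegrableOn, ← Measure.prod_restrict] at hint
  rw [Measure.volume_eq_prod, ← Measure.prod_restrict]
  exact integral_prod_symm _ hint

/-- Lemma 4.6: ε-independent energy-type bounds on (0,T). -/
theorem statement15
    (a b : ℝ) (hab : a < b)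
    (f f' f'' : ℝ → ℝ) (hf : HypF f f' f'')
    (v0 u0 Θ0 : ℝ → ℝ) (hdata : SmoothData a b v0 u0 Θ0)
    (T : ℝ) (hT : 0 < T)
    (v u Θ : ℝ → ℝ → ℝ → ℝ)
    (hsol : ∀ ε ∈ Ioo (0 : ℝ) 1, IsClassicalSolEps a b f ε v0 u0 Θ0 (v ε) (u ε) (Θ ε)) :
    ∃ C > (0 : ℝ), ∀ ε ∈ Ioo (0 : ℝ) 1, ∀ t ∈ Ioo 0 T,
      nrmL2 a b (fun x => v ε x t) + nrmL1 a b (fun x => Θ ε x t)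
          + intOmT a b T (fun x s => (pdx (Θ ε) x s) ^ 2) ≤ C := by
  obtain ⟨M, hM⟩ := hf.bdd
  have hM₁ : ∀ x ∈ Ici (0 : ℝ), |f' x| ≤ M := fun x hx => (hM x hx).1
  set m := 1 / 2 * (∫ x in Ioo a b, v0 x ^ 2) + 1 / 2 * (∫ x in Ioo a b, deriv u0 x ^ 2)
    + ∫ x in Ioo a b, Θ0 x with hm
  have hm0 : 0 ≤ m := by
    have h₁ : 0 ≤ ∫ x in Ioo a b, Θ0 x :=
      setIntegral_nonneg measurableSet_Ioo fun x hx =>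
        (hdata.Θ0_pos x (Ioo_subset_Icc_self hx)).le
    have h₂ : 0 ≤ ∫ x in Ioo a b, v0 x ^ 2 := integral_nonneg fun x => sq_nonneg _
    have h₃ : 0 ≤ ∫ x in Ioo a b, deriv u0 x ^ 2 := integral_nonneg fun x => sq_nonneg _
    positivity
  set δ := 1 / (32 * M ^ 2 * m + 1)
  have hδ : 0 < δ := by positivity
  have hδm : 32 * M ^ 2 * m * δ ≤ 1 := by
    simp only [δ]
    rw [mul_one_div, div_le_one (by positivity)]
    linarith
  set K := 8 * M ^ 2 * m * (2 * (m / (b - a)) ^ 2 + m ^ 2 / δ ^ 2)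
  have hK : 0 ≤ K := by positivity
  have hN : 0 ≤ ∫ x in Ioo a b, Θ0 x ^ 2 := integral_nonneg fun x => sq_nonneg _
  refine ⟨(2 * m) ^ (1 / 2 : ℝ) + m + 2 * ((∫ x in Ioo a b, Θ0 x ^ 2) + K * T) + 1,
    by positivity, fun ε hε t ht => ?_⟩
  have h := hsol ε hε
  have hE0 := h.energy_zero hab
  rw [← hm] at hE0
  have hE : IsClassicalSolEps.energy a b (v ε) (u ε) (Θ ε) t ≤ m :=
    (h.antitoneOn_energy hab hε.1 hf (mem_Ici.2 le_rfl) (mem_Ici.2 ht.1.le) ht.1.le).trans hE0.le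
  have hv : nrmL2 a b (fun x => v ε x t) ≤ (2 * m) ^ (1 / 2 : ℝ) := by
    have := h.integral_v_sq_le hab ht.1.le
    rw [intervalIntegral.integral_of_le hab.le, integral_Ioc_eq_integral_Ioo] at this
    exact Real.rpow_le_rpow (integral_nonneg fun x => sq_nonneg _) (by linarith) (by norm_num)
  have hΘ : nrmL1 a b (fun x => Θ ε x t) ≤ m := by
    have := IsClassicalSolEps.integral_Θ_le_energy hab (v ε) (u ε) (Θ ε) t
    rw [intervalIntegral.integral_of_le hab.le, integral_Ioc_eq_integral_Ioo] at this
    rw [nrmL1, setIntegral_congr_fun (g := fun x => Θ ε x t) measurableSet_Ioo fun x hx =>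
      abs_of_pos (h.Θ_pos x (Ioo_subset_Icc_self hx) t ht.1.le)]
    exact this.trans hE
  have hΘx : intOmT a b T (fun x s => pdx (Θ ε) x s ^ 2)
      ≤ 2 * ((∫ x in Ioo a b, Θ0 x ^ 2) + K * T) := by
    rw [intOmT_eq_intervalIntegral (g := fun x s => pdx (Θ ε) x s ^ 2) hab.le hT.le
      (continuousOn_uncurry_sq (h.cont_Θ 1 (by norm_num)))]
    refine (h.integral_pdx_Θ_sq_le hab hε.1 hf hM₁ hδ hδm hT.le hE0.le).trans_eq ?_
    rw [intervalIntegral.integral_of_le hab.le, integral_Ioc_eq_integral_Ioo,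
      setIntegral_congr_fun (g := fun x => Θ0 x ^ 2) measurableSet_Ioo fun x hx => by
        simp only [(h.init x (Ioo_subset_Icc_self hx)).2.2]]
  linarith
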